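/- arXiv:2307.03928 — 5 statements merged into one kernel-verified Lean document; each statement's English description precedes it below -/
import Mathlib

section
/- Let b > 0, Δ ≥ 0, μ₁ = Δ/b, and α ∈ [0,1]. Then inf{Lap(Δ,b)(Eᶜ) : E ⊆ ℝ measurable, Lap(0,b)(E) ≤ α} = f_Lap(α, μ₁), where f_Lap(α, μ₁) = 1 − α·e^{μ₁} if α < e^{−μ₁}/2, f_Lap(α, μ₁) = e^{−μ₁}/(4α) if e^{−μ₁}/2 ≤ α ≤ 1/2, and f_Lap(α, μ₁) = (1 − α)·e^{−μ₁} if α > 1/2. (Closed-form trade-off function of the Laplace mechanism.) -/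
open MeasureTheory Set

/-- The Laplace measure on `ℝ` with location `m` and scale `b`. -/
noncomputable def Lap (m b : ℝ) : Measure ℝ :=
  volume.withDensity fun x => ENNReal.ofReal ((1 / (2 * b)) * Real.exp (-|x - m| / b))

/-- The closed-form trade-off function of the Laplace mechanism. -/
noncomputable def fLap (α μ₁ : ℝ) : ℝ :=
  if α < Real.exp (-μ₁) / 2 then 1 - α * Real.exp μ₁
  else if α ≤ 1 / 2 then Real.exp (-μ₁) / (4 * α)
  else (1 - α) * Real.exp (-μ₁)

lemma lap_Iic (m b t : ℝ) (hb : 0 < b) (h : t ≤ m) :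
    Lap m b (Iic t) = ENNReal.ofReal (Real.exp ((t - m) / b) / 2) := by
  have hfun : ∀ x ∈ Iic t, (1 / (2 * b)) * Real.exp (-|x - m| / b)
      = (1 / (2 * b) * Real.exp (-m / b)) * Real.exp (b⁻¹ * x) := by
    intro x hx
    have hx' : x - m ≤ 0 := by
      have := mem_Iic.1 hx
      linarith
    rw [abs_of_nonpos hx', mul_assoc, ← Real.exp_add]
    congr 2
    field_simp
    ring
  have hi : IntegrableOn (fun x => Real.exp (b⁻¹ * x)) (Iic t) :=
    integrableOn_exp_mul_Iic (inv_pos.2 hb) t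
  unfold Lap
  rw [withDensity_apply _ measurableSet_Iic,
    setLIntegral_congr_fun measurableSet_Iic (fun x hx => by
      show _ = ENNReal.ofReal ((1 / (2 * b) * Real.exp (-m / b)) * Real.exp (b⁻¹ * x))
      rw [← hfun x hx]),
    ← ofReal_integral_eq_lintegral_ofReal (hi.const_mul _)
      (Filter.Eventually.of_forall fun x => by positivity),
    integral_const_mul, integral_exp_mul_Iic (inv_pos.2 hb)]
  congr 1
  have : (t - m) / b = -m / b + b⁻¹ * t := by field_simp; ring
  rw [this, Real.exp_add]
  field_simp

lemma lap_Ioi (m b t : ℝ) (hb : 0 < b) (h : m ≤ t) :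
    Lap m b (Ioi t) = ENNReal.ofReal (Real.exp (-(t - m) / b) / 2) := by
  have hfun : ∀ x ∈ Ioi t, (1 / (2 * b)) * Real.exp (-|x - m| / b)
      = (1 / (2 * b) * Real.exp (m / b)) * Real.exp (-b⁻¹ * x) := by
    intro x hx
    have hx' : 0 ≤ x - m := by
      have := mem_Ioi.1 hx
      linarith
    rw [abs_of_nonneg hx', mul_assoc, ← Real.exp_add]
    congr 2
    field_simp
    ring
  have hb' : -b⁻¹ < 0 := by
    have := inv_pos.2 hb
    linarith
  have hi : IntegrableOn (fun x => Real.exp (-b⁻¹ * x)) (Ioi t) :=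
    integrableOn_exp_mul_Ioi hb' t
  unfold Lap
  rw [withDensity_apply _ measurableSet_Ioi,
    setLIntegral_congr_fun measurableSet_Ioi (fun x hx => by
      show _ = ENNReal.ofReal ((1 / (2 * b) * Real.exp (m / b)) * Real.exp (-b⁻¹ * x))
      rw [← hfun x hx]),
    ← ofReal_integral_eq_lintegral_ofReal (hi.const_mul _)
      (Filter.Eventually.of_forall fun x => by positivity),
    integral_const_mul, integral_exp_mul_Ioi hb']
  congr 1
  have : -(t - m) / b = m / b + -b⁻¹ * t := by field_simp; ring
  rw [this, Real.exp_add]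
  field_simp

lemma lap_prob (m b : ℝ) (hb : 0 < b) : IsProbabilityMeasure (Lap m b) := by
  constructor
  rw [← Iic_union_Ioi (a := m), measure_union (by simp) measurableSet_Ioi,
    lap_Iic m b m hb le_rfl, lap_Ioi m b m hb le_rfl, ← ENNReal.ofReal_add (by positivity)
    (by positivity)]
  simp only [sub_self, neg_zero, zero_div, Real.exp_zero]
  norm_num

lemma real_Iic (m b t : ℝ) (hb : 0 < b) (h : t ≤ m) :
    (Lap m b).real (Iic t) = Real.exp ((t - m) / b) / 2 := by
  rw [Measure.real, lap_Iic m b t hb h, ENNReal.toReal_ofReal (by positivity)]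

lemma real_Ioi (m b t : ℝ) (hb : 0 < b) (h : m ≤ t) :
    (Lap m b).real (Ioi t) = Real.exp (-(t - m) / b) / 2 := by
  rw [Measure.real, lap_Ioi m b t hb h, ENNReal.toReal_ofReal (by positivity)]

lemma real_compl' (m b : ℝ) (hb : 0 < b) (E : Set ℝ) (hE : MeasurableSet E) :
    (Lap m b).real Eᶜ = 1 - (Lap m b).real E := by
  have := lap_prob m b hb
  exact probReal_compl_eq_one_sub hE

lemma lap_le (m m' b k : ℝ) (hb : 0 < b) (S : Set ℝ) (hS : MeasurableSet S)
    (h : ∀ x ∈ S, -|x - m| / b ≤ k + -|x - m'| / b) :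
    (Lap m b).real S ≤ Real.exp k * (Lap m' b).real S := by
  have := lap_prob m b hb
  have := lap_prob m' b hb
  have key : Lap m b S ≤ ENNReal.ofReal (Real.exp k) * Lap m' b S := by
    unfold Lap
    rw [withDensity_apply _ hS, withDensity_apply _ hS, ← lintegral_const_mul _ (by fun_prop)]
    refine setLIntegral_mono (by fun_prop) fun x hx => ?_
    rw [← ENNReal.ofReal_mul (by positivity)]
    apply ENNReal.ofReal_le_ofReal
    have := Real.exp_le_exp.2 (h x hx)
    rw [Real.exp_add] at this
    calc _ ≤ 1 / (2 * b) * (Real.exp k * Real.exp (-|x - m'| / b)) := by gcongr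
      _ = _ := by ring
  have := ENNReal.toReal_mono (by finiteness) key
  rwa [ENNReal.toReal_mul, ENNReal.toReal_ofReal (by positivity)] at this

lemma abs_mono (Δ x t : ℝ) (hΔ : 0 ≤ Δ) (h : x ≤ t) :
    |x| - |x - Δ| ≤ |t| - |t - Δ| := by
  rcases abs_cases x with ⟨h1, _⟩ | ⟨h1, _⟩ <;> rcases abs_cases (x - Δ) with ⟨h2, _⟩ | ⟨h2, _⟩ <;>
  rcases abs_cases t with ⟨h3, _⟩ | ⟨h3, _⟩ <;> rcases abs_cases (t - Δ) with ⟨h4, _⟩ | ⟨h4, _⟩ <;>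
  rw [h1, h2, h3, h4] <;> linarith

lemma np (b Δ t : ℝ) (hb : 0 < b) (hΔ : 0 ≤ Δ) (E : Set ℝ) (hE : MeasurableSet E)
    (h : (Lap 0 b).real E ≤ (Lap 0 b).real (Ioi t)) :
    (Lap Δ b).real E ≤ (Lap Δ b).real (Ioi t) := by
  have := lap_prob 0 b hb
  have := lap_prob Δ b hb
  set k := (|t| - |t - Δ|) / b with hk
  have h1 := lap_le Δ 0 b k hb (E \ Ioi t) (hE.diff measurableSet_Ioi) (fun x hx => by
    have := abs_mono Δ x t hΔ (not_lt.1 hx.2)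
    rw [hk, ← add_div, sub_zero]
    gcongr
    linarith)
  have h2 := lap_le 0 Δ b (-k) hb (Ioi t \ E) (measurableSet_Ioi.diff hE) (fun x hx => by
    have := abs_mono Δ t x hΔ (le_of_lt hx.1)
    rw [hk, ← neg_div, ← add_div, sub_zero]
    gcongr
    linarith)
  have e1 := measureReal_inter_add_sdiff (μ := Lap 0 b) (s := E) (measurableSet_Ioi (a := t))
  have e2 := measureReal_inter_add_sdiff (μ := Lap 0 b) (s := Ioi t) hE
  have e3 := measureReal_inter_add_sdiff (μ := Lap Δ b) (s := E) (measurableSet_Ioi (a := t))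
  have e4 := measureReal_inter_add_sdiff (μ := Lap Δ b) (s := Ioi t) hE
  rw [inter_comm] at e2 e4
  have h3 : (Lap 0 b).real (E \ Ioi t) ≤ (Lap 0 b).real (Ioi t \ E) := by linarith
  have h4 : Real.exp k * (Lap 0 b).real (Ioi t \ E) ≤ (Lap Δ b).real (Ioi t \ E) := by
    calc _ ≤ Real.exp k * (Real.exp (-k) * (Lap Δ b).real (Ioi t \ E)) := by gcongr
      _ = _ := by rw [← mul_assoc, ← Real.exp_add]; simp
  have h5 : Real.exp k * (Lap 0 b).real (E \ Ioi t) ≤ Real.exp k * (Lap 0 b).real (Ioi t \ E) := by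
    gcongr
  linarith

lemma sInf_of (b Δ α v : ℝ)
    (E : Set ℝ) (hE : MeasurableSet E) (h1 : (Lap 0 b).real E ≤ α) (h2 : (Lap Δ b).real Eᶜ = v)
    (h3 : ∀ F, MeasurableSet F → (Lap 0 b).real F ≤ α → v ≤ (Lap Δ b).real Fᶜ) :
    sInf {x : ℝ | ∃ E : Set ℝ, MeasurableSet E ∧ (Lap 0 b E).toReal ≤ α ∧
        x = (Lap Δ b Eᶜ).toReal} = v := by
  apply IsLeast.csInf_eq
  constructor
  · exact ⟨E, hE, h1, h2.symm⟩
  · rintro x ⟨F, hF, h4, rfl⟩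
    exact h3 F hF h4

lemma sInf_of_t (b Δ α v t : ℝ) (hb : 0 < b) (hΔ : 0 ≤ Δ)
    (h1 : (Lap 0 b).real (Ioi t) = α) (h2 : (Lap Δ b).real (Iic t) = v) :
    sInf {x : ℝ | ∃ E : Set ℝ, MeasurableSet E ∧ (Lap 0 b E).toReal ≤ α ∧
        x = (Lap Δ b Eᶜ).toReal} = v := by
  refine sInf_of b Δ α v (Ioi t) measurableSet_Ioi h1.le (by rwa [compl_Ioi]) ?_
  intro F hF hF1
  have := np b Δ t hb hΔ F hF (by rwa [h1])
  rw [← h2, ← compl_Ioi, real_compl' _ _ hb _ hF, real_compl' _ _ hb _ measurableSet_Ioi]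
  linarith

/-- Closed-form trade-off function of the Laplace mechanism:
`T(Lap(0,b), Lap(Δ,b))(α) = f_Lap(α, Δ/b)`. -/
theorem tradeOff_laplace (b Δ : ℝ) (hb : 0 < b) (hΔ : 0 ≤ Δ)
    (μ₁ : ℝ) (hμ₁ : μ₁ = Δ / b) (α : ℝ) (hα : α ∈ Icc (0 : ℝ) 1) :
    sInf {x : ℝ | ∃ E : Set ℝ, MeasurableSet E ∧ (Lap 0 b E).toReal ≤ α ∧
        x = (Lap Δ b Eᶜ).toReal} = fLap α μ₁ := by
  obtain ⟨h0, h1⟩ := hα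
  have hΔb : Δ = μ₁ * b := by rw [hμ₁]; field_simp
  have hμ0 : 0 ≤ μ₁ := by rw [hμ₁]; positivity
  rcases h0.eq_or_lt with rfl | h0
  · have hf : fLap 0 μ₁ = 1 := by
      unfold fLap
      rw [if_pos (by positivity)]
      simp
    rw [hf]
    refine sInf_of b Δ 0 1 ∅ MeasurableSet.empty (by simp) ?_ ?_
    · rw [real_compl' _ _ hb _ MeasurableSet.empty]; simp
    · intro F hF h
      have := lap_le Δ 0 b μ₁ hb F hF (fun x _ => by
        rw [hμ₁, ← add_div]
        gcongr
        have := abs_sub_abs_le_abs_sub x (x - Δ)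
        rw [sub_sub_cancel, abs_of_nonneg hΔ] at this
        rw [sub_zero]
        linarith)
      have h' : Real.exp μ₁ * (Lap 0 b).real F ≤ 0 :=
        mul_nonpos_of_nonneg_of_nonpos (by positivity) h
      rw [real_compl' _ _ hb _ hF]
      linarith
  have hexp1 : Real.exp (-μ₁) ≤ 1 := by simpa using hμ0
  rcases h1.eq_or_lt with rfl | h1
  · have hf : fLap 1 μ₁ = 0 := by
      unfold fLap
      rw [if_neg (by linarith), if_neg (by norm_num)]
      simp
    rw [hf]
    have := lap_prob 0 b hb
    refine sInf_of b Δ 1 0 univ MeasurableSet.univ (by simp) (by simp) ?_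
    intro F hF h
    exact measureReal_nonneg
  unfold fLap
  have hinv : ∀ y : ℝ, 0 < y → Real.exp (-Real.log y) = y⁻¹ := fun y hy => by
    rw [Real.exp_neg, Real.exp_log hy]
  split_ifs with c1 c2
  · have hl : μ₁ < -Real.log (2 * α) := by
      have : Real.log (2 * α) < -μ₁ := (Real.log_lt_iff_lt_exp (by positivity)).2 (by linarith)
      linarith
    have hle : Δ ≤ -Real.log (2 * α) * b := by rw [hΔb]; gcongr
    refine sInf_of_t b Δ α _ (-Real.log (2 * α) * b) hb hΔ ?_ ?_
    · rw [real_Ioi 0 b _ hb (by linarith)]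
      have : -(-Real.log (2 * α) * b - 0) / b = Real.log (2 * α) := by field_simp; ring
      rw [this, Real.exp_log (by positivity)]
      ring
    · rw [← compl_Ioi, real_compl' _ _ hb _ measurableSet_Ioi, real_Ioi Δ b _ hb hle]
      have : -(-Real.log (2 * α) * b - Δ) / b = Real.log (2 * α) + μ₁ := by
        rw [hΔb]; field_simp; ring
      rw [this, Real.exp_add, Real.exp_log (by positivity)]
      ring
  · have hl : -Real.log (2 * α) ≤ μ₁ := by
      have : -μ₁ ≤ Real.log (2 * α) := (Real.le_log_iff_exp_le (by positivity)).2 (by linarith)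
      linarith
    have hl0 : 0 ≤ -Real.log (2 * α) := by
      have := Real.log_nonpos (x := 2 * α) (by positivity) (by linarith)
      linarith
    have hle : -Real.log (2 * α) * b ≤ Δ := by rw [hΔb]; gcongr
    refine sInf_of_t b Δ α _ (-Real.log (2 * α) * b) hb hΔ ?_ ?_
    · rw [real_Ioi 0 b _ hb (by positivity)]
      have : -(-Real.log (2 * α) * b - 0) / b = Real.log (2 * α) := by field_simp; ring
      rw [this, Real.exp_log (by positivity)]
      ring
    · rw [real_Iic Δ b _ hb hle]
      have : (-Real.log (2 * α) * b - Δ) / b = -Real.log (2 * α) + -μ₁ := by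
        rw [hΔb]; field_simp; ring
      rw [this, Real.exp_add, hinv _ (by positivity)]
      field_simp
      ring
  · have hp : 0 < 2 * (1 - α) := by linarith
    have hl0 : Real.log (2 * (1 - α)) ≤ 0 := Real.log_nonpos hp.le (by linarith)
    have hle : Real.log (2 * (1 - α)) * b ≤ 0 := mul_nonpos_of_nonpos_of_nonneg hl0 hb.le
    refine sInf_of_t b Δ α _ (Real.log (2 * (1 - α)) * b) hb hΔ ?_ ?_
    · rw [← compl_Iic, real_compl' _ _ hb _ measurableSet_Iic, real_Iic 0 b _ hb hle]
      have : (Real.log (2 * (1 - α)) * b - 0) / b = Real.log (2 * (1 - α)) := by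
        field_simp; ring
      rw [this, Real.exp_log hp]
      ring
    · rw [real_Iic Δ b _ hb (by linarith)]
      have : (Real.log (2 * (1 - α)) * b - Δ) / b = Real.log (2 * (1 - α)) + -μ₁ := by
        rw [hΔb]; field_simp; ring
      rw [this, Real.exp_add, Real.exp_log hp]
      ring
end

section
/- Let σ > 0, Δ ≥ 0, μ₂ = Δ/σ, α ∈ (0,1), and let c ∈ ℝ satisfy Φ(c) = 1 − α, where Φ is the standard normal CDF. Then inf{N(Δ, σ²)(Eᶜ) : E ⊆ ℝ measurable, N(0, σ²)(E) ≤ α} = Φ(c − μ₂). (Closed-form trade-off function of the Gaussian mechanism: f_Gauss(α, μ₂) = Φ(Φ⁻¹(1 − α) − μ₂).) -/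
open MeasureTheory Set ProbabilityTheory NNReal

/-- The standard normal cumulative distribution function. -/
noncomputable def Phi (x : ℝ) : ℝ := (gaussianReal 0 1 (Iic x)).toReal

lemma aux_cdf (σ : ℝ≥0) (hσ : 0 < σ) (m t : ℝ) :
    (gaussianReal m (σ ^ 2) (Iic t)).toReal = Phi ((t - m) / σ) := by
  have hs : (0 : ℝ) < σ := by exact_mod_cast hσ
  have h : gaussianReal m (σ ^ 2) =
      ((gaussianReal 0 1).map (fun x => (σ : ℝ) * x)).map (fun x => x + m) := by
    rw [gaussianReal_map_const_mul, gaussianReal_map_add_const]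
    congr 1
    · simp
    · ext; simp
  rw [h, Measure.map_apply (by fun_prop) measurableSet_Iic,
    Measure.map_apply (by fun_prop) (measurableSet_Iic.preimage (by fun_prop)), Phi]
  congr 2
  ext x
  simp only [mem_preimage, mem_Iic]
  rw [le_div_iff₀ hs]
  constructor <;> intro h <;> linarith

lemma aux_pdf (v : ℝ≥0) (Δ x : ℝ) (hv : v ≠ 0) :
    gaussianPDFReal Δ v x =
      Real.exp ((2 * x * Δ - Δ ^ 2) / (2 * v)) * gaussianPDFReal 0 v x := by
  have : (v : ℝ) ≠ 0 := by exact_mod_cast hv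
  rw [gaussianPDFReal, gaussianPDFReal, mul_left_comm, ← Real.exp_add]
  congr 2
  field_simp
  ring

lemma aux_real (v : ℝ≥0) (hv : v ≠ 0) (m : ℝ) (E : Set ℝ) :
    (gaussianReal m v E).toReal = ∫ x in E, gaussianPDFReal m v x := by
  rw [gaussianReal_apply_eq_integral m hv, ENNReal.toReal_ofReal]
  exact integral_nonneg fun x => gaussianPDFReal_nonneg m v x

lemma aux_np (v : ℝ≥0) (hv : v ≠ 0) (Δ t : ℝ) (hΔ : 0 ≤ Δ) (E : Set ℝ) (hE : MeasurableSet E)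
    (h : (gaussianReal 0 v E).toReal ≤ (gaussianReal 0 v (Ioi t)).toReal) :
    (gaussianReal Δ v E).toReal ≤ (gaussianReal Δ v (Ioi t)).toReal := by
  set k := Real.exp ((2 * t * Δ - Δ ^ 2) / (2 * v)) with hk
  have hk0 : 0 < k := Real.exp_pos _
  have hq := integrable_gaussianPDFReal Δ v
  have hp := (integrable_gaussianPDFReal 0 v).const_mul k
  have key : ∫ x in E, (gaussianPDFReal Δ v x - k * gaussianPDFReal 0 v x) ≤
      ∫ x in Ioi t, (gaussianPDFReal Δ v x - k * gaussianPDFReal 0 v x) := by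
    rw [← integral_indicator hE, ← integral_indicator measurableSet_Ioi]
    refine integral_mono ((hq.sub hp).indicator hE) ((hq.sub hp).indicator measurableSet_Ioi) ?_
    intro x
    have hp0 := gaussianPDFReal_nonneg 0 v x
    have h1 : t < x → 0 ≤ gaussianPDFReal Δ v x - k * gaussianPDFReal 0 v x := by
      intro hx
      rw [aux_pdf v Δ x hv, hk, sub_nonneg]
      gcongr
    have h2 : x ≤ t → gaussianPDFReal Δ v x - k * gaussianPDFReal 0 v x ≤ 0 := by
      intro hx
      rw [aux_pdf v Δ x hv, hk, sub_nonpos]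
      gcongr
    simp only [indicator, mem_Ioi]
    split_ifs with a b b
    · exact le_rfl
    · exact h2 (not_lt.mp b)
    · exact h1 b
    · exact le_rfl
  rw [integral_sub hq.integrableOn hp.integrableOn, integral_sub hq.integrableOn hp.integrableOn,
    integral_const_mul, integral_const_mul, ← aux_real v hv, ← aux_real v hv,
    ← aux_real v hv, ← aux_real v hv] at key
  nlinarith [mul_le_mul_of_nonneg_left h hk0.le]

/-- Closed-form trade-off function of the Gaussian mechanism:
`T(N(0,σ²), N(Δ,σ²))(α) = Φ(Φ⁻¹(1 - α) - μ₂)` with `μ₂ = Δ/σ`. -/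
theorem tradeOff_gaussian (σ : ℝ≥0) (hσ : 0 < σ) (Δ : ℝ) (hΔ : 0 ≤ Δ)
    (μ₂ : ℝ) (hμ₂ : μ₂ = Δ / (σ : ℝ))
    (α : ℝ) (hα : α ∈ Ioo (0 : ℝ) 1) (c : ℝ) (hc : Phi c = 1 - α) :
    sInf {x : ℝ | ∃ E : Set ℝ, MeasurableSet E ∧
        (gaussianReal 0 (σ ^ 2) E).toReal ≤ α ∧
        x = (gaussianReal Δ (σ ^ 2) Eᶜ).toReal} = Phi (c - μ₂) := by
  have hs : (σ : ℝ) ≠ 0 := by exact_mod_cast hσ.ne'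
  have hv : σ ^ 2 ≠ 0 := pow_ne_zero _ hσ.ne'
  have hcompl : ∀ (m : ℝ) (E : Set ℝ), MeasurableSet E →
      (gaussianReal m (σ ^ 2) Eᶜ).toReal = 1 - (gaussianReal m (σ ^ 2) E).toReal :=
    fun m E hE => probReal_compl_eq_one_sub hE
  have h0 : (gaussianReal 0 (σ ^ 2) (Ioi (σ * c))).toReal = α := by
    rw [← compl_Iic, hcompl _ _ measurableSet_Iic, aux_cdf σ hσ, sub_zero,
      mul_div_cancel_left₀ _ hs, hc]
    ring
  have h1 : (gaussianReal Δ (σ ^ 2) (Ioi (σ * c))ᶜ).toReal = Phi (c - μ₂) := by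
    rw [compl_Ioi, aux_cdf σ hσ, hμ₂, _root_.sub_div, mul_div_cancel_left₀ _ hs]
  apply IsLeast.csInf_eq
  refine ⟨⟨Ioi (σ * c), measurableSet_Ioi, h0.le, h1.symm⟩, ?_⟩
  rintro x ⟨E, hE, hEα, rfl⟩
  rw [← h1, hcompl _ _ hE, hcompl _ _ measurableSet_Ioi]
  have := aux_np (σ ^ 2) hv Δ (σ * c) hΔ E hE (by rw [h0]; exact hEα)
  linarith
end

section
/- Let σ > 0, Δ ≥ 0, μ₂ = Δ/σ, let N ≥ 1 be a natural number, let κ ∈ (0,1), and let c ∈ ℝ satisfy Φ(c) = 1 − κ, where Φ is the standard normal CDF. Let P be the product measure on ℝ^N of N copies of N(0, σ²) and let Q be the product measure of N copies of N(Δ, σ²). Then sup{Q(E) : E ⊆ ℝ^N measurable, P(E) ≤ κ} = 1 − Φ(c − √N·μ₂). (Under N-fold homogeneous composition, the Gaussian mechanism satisfies (η, γ)-ReRo with γ = 1 − f_Gauss(κ(η), √N·μ₂).) -/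
open MeasureTheory Set ProbabilityTheory NNReal

lemma sum_law (N : ℕ) (m : ℝ) (v : ℝ≥0) :
    (Measure.pi (fun _ : Fin N => gaussianReal m v)).map (fun x => ∑ i, x i) =
      gaussianReal (N * m) (N * v) := by
  refine Measure.ext_of_charFun ?_
  rw [charFun_map_sum_pi_eq_prod]
  ext t
  simp only [Finset.prod_const, Finset.card_univ, Fintype.card_fin, Pi.pow_apply,
    charFun_gaussianReal, ← Complex.exp_nat_mul]
  congr 1
  push_cast
  ring

lemma gauss_dens (Δ : ℝ) (σ : ℝ≥0) (hσ : 0 < σ) :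
    gaussianReal Δ (σ ^ 2) = (gaussianReal 0 (σ ^ 2)).withDensity
      (fun x => ENNReal.ofReal (Real.exp ((Δ * x - Δ ^ 2 / 2) / σ ^ 2))) := by
  have h : σ ^ 2 ≠ 0 := by positivity
  rw [gaussianReal_of_var_ne_zero _ h, gaussianReal_of_var_ne_zero _ h,
    ← withDensity_mul _ (measurable_gaussianPDF _ _) (by fun_prop)]
  congr 1
  ext x
  have hs : (σ : ℝ) ≠ 0 := by exact_mod_cast hσ.ne'
  simp only [gaussianPDF, Pi.mul_apply]
  rw [← ENNReal.ofReal_mul (gaussianPDFReal_nonneg _ _ _)]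
  congr 1
  simp only [gaussianPDFReal]
  rw [mul_assoc (_)⁻¹ (Real.exp _), ← Real.exp_add]
  congr 2
  push_cast
  field_simp
  ring

lemma pi_dens (N : ℕ) (ν : Measure ℝ) [IsProbabilityMeasure ν] (f : ℝ → ENNReal)
    (hf : Measurable f) (μ : Measure ℝ) [IsProbabilityMeasure μ] (h : μ = ν.withDensity f) :
    Measure.pi (fun _ : Fin N => μ) =
      (Measure.pi (fun _ : Fin N => ν)).withDensity (fun x => ∏ i, f (x i)) := by
  apply Measure.pi_eq
  intro s hs
  have hm : MeasurableSet (univ.pi s) := MeasurableSet.univ_pi hs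
  rw [withDensity_apply _ hm, ← lintegral_indicator hm]
  have hmi : ∀ i, Measurable ((s i).indicator f) := fun i => hf.indicator (hs i)
  have e : (univ.pi s).indicator (fun x : Fin N → ℝ => ∏ i, f (x i)) =
      fun x => ∏ i, (s i).indicator f (x i) := by
    ext x
    by_cases hx : x ∈ univ.pi s
    · rw [indicator_of_mem hx]
      refine Finset.prod_congr rfl fun i _ => ?_
      rw [indicator_of_mem (hx i (mem_univ _))]
    · rw [indicator_of_notMem hx]
      simp only [mem_univ_pi, not_forall] at hx
      obtain ⟨i, hi⟩ := hx
      exact (Finset.prod_eq_zero (Finset.mem_univ i) (indicator_of_notMem hi _)).symm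
  rw [e, lintegral_prod_eq_prod_lintegral_of_indepFun Finset.univ
    (fun i (x : Fin N → ℝ) => (s i).indicator f (x i))
    (iIndepFun_pi fun i => (hmi i).aemeasurable) fun i => (hmi i).comp (measurable_pi_apply i)]
  refine Finset.prod_congr rfl fun i _ => ?_
  rw [h, withDensity_apply _ (hs i), ← lintegral_indicator (hs i)]
  exact (measurePreserving_eval (fun _ : Fin N => ν) i).lintegral_comp (hmi i)

lemma tail (N : ℕ) (hN : 1 ≤ N) (m : ℝ) (σ : ℝ≥0) (hσ : 0 < σ) (t : ℝ) :
    ((Measure.pi (fun _ : Fin N => gaussianReal m (σ ^ 2))) {x | t < ∑ i, x i}).toReal =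
      1 - Phi ((t - N * m) / (σ * Real.sqrt N)) := by
  have hN' : (0:ℝ) < N := by exact_mod_cast hN
  have hs : (0:ℝ) < σ := by exact_mod_cast hσ
  have hsq : 0 < Real.sqrt N := Real.sqrt_pos.2 hN'
  have h1 : (gaussianReal (N * m) (N * σ ^ 2)) =
      ((gaussianReal 0 1).map (fun x => (σ * Real.sqrt N) * x)).map (fun x => x + N * m) := by
    rw [gaussianReal_map_const_mul, gaussianReal_map_add_const]
    congr 1
    · simp
    · ext; push_cast; rw [mul_one, mul_pow, Real.sq_sqrt hN'.le, mul_comm]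
  have h2 : {x : Fin N → ℝ | t < ∑ i, x i} = (fun x : Fin N → ℝ => ∑ i, x i) ⁻¹' (Ioi t) := rfl
  rw [h2, ← Measure.map_apply (by fun_prop) measurableSet_Ioi, sum_law, h1,
    Measure.map_apply (by fun_prop) measurableSet_Ioi,
    Measure.map_apply (by fun_prop) (measurableSet_Ioi.preimage (by fun_prop))]
  have h3 : (fun x : ℝ => (σ * Real.sqrt N) * x) ⁻¹' ((fun x => x + N * m) ⁻¹' Ioi t) =
      (Iic ((t - N * m) / (σ * Real.sqrt N)))ᶜ := by
    ext x
    simp only [mem_preimage, mem_Ioi, mem_compl_iff, mem_Iic, not_le]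
    rw [div_lt_iff₀ (by positivity), sub_lt_iff_lt_add, mul_comm x]
  rw [h3]
  exact probReal_compl_eq_one_sub measurableSet_Iic

lemma np_s7 {Ω : Type*} [MeasurableSpace Ω] (P Q : Measure Ω) [IsProbabilityMeasure P]
    [IsProbabilityMeasure Q] (L : Ω → ENNReal)
    (h : Q = P.withDensity L) (k : ℝ≥0) (A E : Set Ω) (hA : MeasurableSet A)
    (hE : MeasurableSet E) (h1 : ∀ x ∈ A, k ≤ L x) (h2 : ∀ x ∉ A, L x ≤ k)
    (hEA : P.real E ≤ P.real A) : Q.real E ≤ Q.real A := by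
  have a1 : Q (E \ A) ≤ k * P (E \ A) := by
    rw [h, withDensity_apply _ (hE.diff hA), ← setLIntegral_const]
    exact setLIntegral_mono' (hE.diff hA) fun x hx => h2 x hx.2
  have a2 : k * P (A \ E) ≤ Q (A \ E) := by
    rw [h, withDensity_apply _ (hA.diff hE), ← setLIntegral_const]
    exact setLIntegral_mono' (hA.diff hE) fun x hx => h1 x hx.1
  have b1 : Q.real (E \ A) ≤ k * P.real (E \ A) := by
    have := ENNReal.toReal_mono (by finiteness) a1
    simpa [Measure.real] using this
  have b2 : k * P.real (A \ E) ≤ Q.real (A \ E) := by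
    have := ENNReal.toReal_mono (by finiteness) a2
    simpa [Measure.real] using this
  have c1 := measureReal_inter_add_diff (μ := P) (s := E) hA
  have c2 := measureReal_inter_add_diff (μ := P) (s := A) hE
  have c3 := measureReal_inter_add_diff (μ := Q) (s := E) hA
  have c4 := measureReal_inter_add_diff (μ := Q) (s := A) hE
  rw [inter_comm] at c2 c4
  have : (k : ℝ) * P.real (E \ A) ≤ k * P.real (A \ E) :=
    mul_le_mul_of_nonneg_left (by linarith) k.2
  linarith

/-- Under `N`-fold homogeneous composition, the Gaussian mechanism satisfies
`(η, γ)`-ReRo with `γ = 1 - f_Gauss(κ(η), √N · μ₂)`: the blow-up between the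
`N`-fold product measures of `N(Δ,σ²)` and `N(0,σ²)` equals `1 - Φ(c - √N·μ₂)`. -/
theorem blowup_gaussian_composition (σ : ℝ≥0) (hσ : 0 < σ) (Δ : ℝ) (hΔ : 0 ≤ Δ)
    (μ₂ : ℝ) (hμ₂ : μ₂ = Δ / (σ : ℝ)) (N : ℕ) (hN : 1 ≤ N)
    (κ : ℝ) (hκ : κ ∈ Ioo (0 : ℝ) 1) (c : ℝ) (hc : Phi c = 1 - κ)
    (P Q : Measure (Fin N → ℝ))
    (hP : P = Measure.pi fun _ => gaussianReal 0 (σ ^ 2))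
    (hQ : Q = Measure.pi fun _ => gaussianReal Δ (σ ^ 2)) :
    sSup {x : ℝ | ∃ E : Set (Fin N → ℝ), MeasurableSet E ∧
        (P E).toReal ≤ κ ∧ x = (Q E).toReal} =
      1 - Phi (c - Real.sqrt N * μ₂) := by
  have hN' : (0:ℝ) < N := by exact_mod_cast hN
  have hs : (0:ℝ) < σ := by exact_mod_cast hσ
  have hsq : 0 < Real.sqrt N := Real.sqrt_pos.2 hN'
  set t : ℝ := c * (σ * Real.sqrt N) with ht
  set A : Set (Fin N → ℝ) := {x | t < ∑ i, x i} with hA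
  have hAm : MeasurableSet A := measurableSet_lt measurable_const (by fun_prop)
  have hPA : (P A).toReal = κ := by
    rw [hP, hA, tail N hN 0 σ hσ t]
    have : (t - N * 0) / (σ * Real.sqrt N) = c := by rw [ht]; field_simp; ring
    rw [this, hc]; ring
  have hQA : (Q A).toReal = 1 - Phi (c - Real.sqrt N * μ₂) := by
    rw [hQ, hA, tail N hN Δ σ hσ t]
    congr 2
    rw [ht, hμ₂]
    have : (N : ℝ) = Real.sqrt N * Real.sqrt N := (Real.mul_self_sqrt hN'.le).symm
    rw [div_eq_iff (by positivity), sub_mul]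
    congr 1
    nth_rewrite 1 [this]
    field_simp
  have hd : Q = P.withDensity (fun x => ENNReal.ofReal
      (Real.exp ((Δ * (∑ i, x i) - N * (Δ ^ 2 / 2)) / σ ^ 2))) := by
    rw [hP, hQ, pi_dens N (gaussianReal 0 (σ ^ 2)) _ (by fun_prop) _ (gauss_dens Δ σ hσ)]
    congr 1
    ext x
    rw [← ENNReal.ofReal_prod_of_nonneg (fun _ _ => (Real.exp_pos _).le), ← Real.exp_sum,
      ← Finset.sum_div, Finset.sum_sub_distrib, ← Finset.mul_sum]
    simp
  have iP : IsProbabilityMeasure P := by rw [hP]; infer_instance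
  have iQ : IsProbabilityMeasure Q := by rw [hQ]; infer_instance
  apply IsGreatest.csSup_eq
  refine ⟨⟨A, hAm, hPA.le, hQA.symm⟩, ?_⟩
  rintro _ ⟨E, hE, hPE, rfl⟩
  rw [← hQA]
  refine np_s7 P Q _ hd (Real.exp ((Δ * t - N * (Δ ^ 2 / 2)) / σ ^ 2)).toNNReal A E hAm hE
    ?_ ?_ (hPE.trans hPA.ge)
  · intro x hx
    have hx' : t ≤ ∑ i, x i := le_of_lt hx
    apply ENNReal.ofReal_le_ofReal
    gcongr
  · intro x hx
    have hx' : ∑ i, x i ≤ t := not_lt.1 hx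
    apply ENNReal.ofReal_le_ofReal
    gcongr
end

section
/- Let N ≥ 1 be a natural number, and for i = 1, …, N let σᵢ > 0, Δᵢ ≥ 0 and μᵢ = Δᵢ/σᵢ. Let κ ∈ (0,1) and let c ∈ ℝ satisfy Φ(c) = 1 − κ, where Φ is the standard normal CDF. Let P = ⊗ᵢ N(0, σᵢ²) and Q = ⊗ᵢ N(Δᵢ, σᵢ²) be the product measures on ℝ^N. Then sup{Q(E) : E ⊆ ℝ^N measurable, P(E) ≤ κ} = 1 − Φ(c − √(μ₁² + μ₂² + ⋯ + μ_N²)). (Under heterogeneous composition of Gaussian mechanisms with effect sizes μ₁, μ₂, …, the ReRo bound is γ = 1 − f_Gauss(κ(η), √(μ₁² + μ₂² + ⋯)).) -/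
open MeasureTheory Set ProbabilityTheory NNReal

lemma aux_gauss_density (d : ℝ) (v : ℝ≥0) (hv : v ≠ 0) :
    gaussianReal d v = (gaussianReal 0 v).withDensity
      (fun x => ENNReal.ofReal (Real.exp (d * x / v - d ^ 2 / (2 * v)))) := by
  rw [gaussianReal_of_var_ne_zero _ hv, gaussianReal_of_var_ne_zero _ hv,
    ← withDensity_mul _ (measurable_gaussianPDF _ _) (by fun_prop)]
  congr 1
  ext x
  have hv' : (v : ℝ) ≠ 0 := by exact_mod_cast hv
  simp only [Pi.mul_apply, gaussianPDF, gaussianPDFReal]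
  rw [← ENNReal.ofReal_mul (by positivity), mul_assoc (Real.sqrt _)⁻¹, ← Real.exp_add]
  congr 3
  field_simp
  ring

lemma aux_pi_density (N : ℕ) (p q : Fin N → Measure ℝ)
    [∀ i, IsProbabilityMeasure (p i)] [∀ i, IsProbabilityMeasure (q i)]
    (f : Fin N → ℝ → ENNReal) (hf : ∀ i, Measurable (f i))
    (h : ∀ i, q i = (p i).withDensity (f i)) :
    Measure.pi q = (Measure.pi p).withDensity (fun x => ∏ i, f i (x i)) := by
  refine Measure.pi_eq fun s hs => ?_
  rw [withDensity_apply _ (MeasurableSet.univ_pi hs),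
    ← lintegral_indicator (MeasurableSet.univ_pi hs)]
  have e1 : (pi univ s).indicator (fun x => ∏ i, f i (x i))
      = fun x => ∏ i, (s i).indicator (f i) (x i) := by
    ext x
    by_cases hx : x ∈ pi univ s
    · rw [indicator_of_mem hx]
      exact Finset.prod_congr rfl fun i _ => (indicator_of_mem (hx i (mem_univ i)) _).symm
    · rw [indicator_of_notMem hx]
      simp only [mem_pi, mem_univ, true_imp_iff, not_forall] at hx
      obtain ⟨i, hi⟩ := hx
      exact (Finset.prod_eq_zero (Finset.mem_univ i) (indicator_of_notMem hi _)).symm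
  have hm : ∀ i, Measurable ((s i).indicator (f i)) := fun i => (hf i).indicator (hs i)
  rw [e1, lintegral_prod_eq_prod_lintegral_of_indepFun Finset.univ
    (fun i (x : Fin N → ℝ) => (s i).indicator (f i) (x i))
    (iIndepFun_pi (fun i => (hm i).aemeasurable))
    (fun i => (hm i).comp (measurable_pi_apply i))]
  refine Finset.prod_congr rfl fun i _ => ?_
  rw [(measurePreserving_eval p i).lintegral_comp (hm i), lintegral_indicator (hs i), h i,
    withDensity_apply _ (hs i)]

lemma aux_map_sum (N : ℕ) (m : Fin N → ℝ) (v : Fin N → ℝ≥0) (a : Fin N → ℝ) (s : Finset (Fin N)) :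
    (Measure.pi fun i => gaussianReal (m i) (v i)).map (∑ i ∈ s, fun x : Fin N → ℝ => a i * x i)
      = gaussianReal (∑ i ∈ s, a i * m i) (∑ i ∈ s, NNReal.mk (a i ^ 2) (sq_nonneg _) * v i) := by
  have hi : iIndepFun (fun i (x : Fin N → ℝ) => a i * x i)
      (Measure.pi fun i => gaussianReal (m i) (v i)) :=
    iIndepFun_pi (X := fun i (y : ℝ) => a i * y) (fun i => by fun_prop)
  have hm : ∀ i, AEMeasurable (fun x : Fin N → ℝ => a i * x i)
      (Measure.pi fun i => gaussianReal (m i) (v i)) := fun i => by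
    have : Measurable (fun x : Fin N → ℝ => a i * x i) := by fun_prop
    exact this.aemeasurable
  induction s using Finset.induction_on with
  | empty =>
    simp only [Finset.sum_empty, gaussianReal_zero_var]
    have : (0 : (Fin N → ℝ) → ℝ) = fun _ => 0 := rfl
    rw [this, Measure.map_const]
    simp
  | insert j s hj ih =>
    rw [Finset.sum_insert hj, Finset.sum_insert hj, Finset.sum_insert hj]
    refine gaussianReal_add_gaussianReal_of_indepFun
      (hi.indepFun_finsetSum_of_notMem₀ hm hj).symm ?_ ih
    have : (fun x : Fin N → ℝ => a j * x j) = (fun y => a j * y) ∘ Function.eval j := rfl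
    rw [this, ← Measure.map_map (by fun_prop) (by fun_prop),
      (measurePreserving_eval _ j).map_eq, gaussianReal_map_const_mul]

lemma aux_Ioi (m c : ℝ) : (gaussianReal m 1 (Ioi c)).toReal = 1 - Phi (c - m) := by
  have h : gaussianReal m 1 = (gaussianReal 0 1).map (· + m) := by
    rw [gaussianReal_map_add_const, zero_add]
  rw [Phi, h, Measure.map_apply (by fun_prop) measurableSet_Ioi]
  have e : (fun x : ℝ => x + m) ⁻¹' Ioi c = (Iic (c - m))ᶜ := by
    ext x; simp [sub_lt_iff_lt_add]
  rw [e]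
  exact probReal_compl_eq_one_sub measurableSet_Iic

lemma aux_NP {Ω : Type*} [MeasurableSpace Ω] (P Q : Measure Ω) [IsProbabilityMeasure P]
    [IsProbabilityMeasure Q] (f : Ω → ℝ) (hf : Measurable f) (hf0 : ∀ x, 0 ≤ f x)
    (hQ : Q = P.withDensity (fun x => ENNReal.ofReal (f x))) (t : ℝ) (ht : 0 ≤ t)
    (S E : Set Ω) (hS : MeasurableSet S) (hE : MeasurableSet E)
    (h1 : ∀ x ∈ S, t ≤ f x) (h2 : ∀ x ∉ S, f x ≤ t)
    (hP : P.real E ≤ P.real S) : Q.real E ≤ Q.real S := by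
  have a1 : Q (E \ S) ≤ ENNReal.ofReal t * P (E \ S) := by
    rw [hQ, withDensity_apply _ (hE.diff hS), ← setLIntegral_const]
    exact setLIntegral_mono measurable_const
      fun x hx => ENNReal.ofReal_le_ofReal (h2 x hx.2)
  have a2 : ENNReal.ofReal t * P (S \ E) ≤ Q (S \ E) := by
    rw [hQ, withDensity_apply _ (hS.diff hE), ← setLIntegral_const]
    exact setLIntegral_mono (by fun_prop)
      fun x hx => ENNReal.ofReal_le_ofReal (h1 x hx.1)
  have b1 : Q.real (E \ S) ≤ t * P.real (E \ S) := by
    have := ENNReal.toReal_mono (ENNReal.mul_ne_top ENNReal.ofReal_ne_top (measure_ne_top _ _)) a1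
    rwa [ENNReal.toReal_mul, ENNReal.toReal_ofReal ht] at this
  have b2 : t * P.real (S \ E) ≤ Q.real (S \ E) := by
    have := ENNReal.toReal_mono (measure_ne_top _ _) a2
    rwa [ENNReal.toReal_mul, ENNReal.toReal_ofReal ht] at this
  have c1 := measureReal_inter_add_sdiff (μ := P) (s := E) hS
  have c2 := measureReal_inter_add_sdiff (μ := P) (s := S) hE
  have c3 := measureReal_inter_add_sdiff (μ := Q) (s := E) hS
  have c4 := measureReal_inter_add_sdiff (μ := Q) (s := S) hE
  rw [inter_comm] at c2 c4
  have : t * P.real (E \ S) ≤ t * P.real (S \ E) := mul_le_mul_of_nonneg_left (by linarith) ht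
  linarith

lemma aux_dir (N : ℕ) (hN : 1 ≤ N) (μ : Fin N → ℝ) :
    ∃ w : Fin N → ℝ, ∑ i, w i ^ 2 = 1 ∧ ∀ i, μ i = Real.sqrt (∑ i, μ i ^ 2) * w i := by
  have h0 : 0 ≤ ∑ i, μ i ^ 2 := Finset.sum_nonneg fun i _ => sq_nonneg _
  by_cases h : ∑ i, μ i ^ 2 = 0
  · refine ⟨Pi.single ⟨0, hN⟩ 1, ?_, fun i => ?_⟩
    · rw [Finset.sum_eq_single ⟨0, hN⟩]
      · simp
      · intro b _ hb; simp [Pi.single_apply, hb]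
      · simp
    · rw [h]
      rw [Finset.sum_eq_zero_iff_of_nonneg fun i _ => sq_nonneg _] at h
      simpa using h i (Finset.mem_univ i)
  · have hs : Real.sqrt (∑ i, μ i ^ 2) ≠ 0 := by rwa [Ne, Real.sqrt_eq_zero h0]
    refine ⟨fun i => μ i / Real.sqrt (∑ i, μ i ^ 2), ?_, fun i => ?_⟩
    · simp_rw [div_pow, Real.sq_sqrt h0]
      rw [← Finset.sum_div, div_self h]
    · field_simp

theorem blowup_gaussian_heterogeneous_composition (N : ℕ) (hN : 1 ≤ N)
    (σ : Fin N → ℝ≥0) (hσ : ∀ i, 0 < σ i) (Δ : Fin N → ℝ) (hΔ : ∀ i, 0 ≤ Δ i)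
    (μ : Fin N → ℝ) (hμ : ∀ i, μ i = Δ i / (σ i : ℝ))
    (κ : ℝ) (hκ : κ ∈ Ioo (0 : ℝ) 1) (c : ℝ) (hc : Phi c = 1 - κ)
    (P Q : Measure (Fin N → ℝ))
    (hP : P = Measure.pi fun i => gaussianReal 0 (σ i ^ 2))
    (hQ : Q = Measure.pi fun i => gaussianReal (Δ i) (σ i ^ 2)) :
    sSup {x : ℝ | ∃ E : Set (Fin N → ℝ), MeasurableSet E ∧
        (P E).toReal ≤ κ ∧ x = (Q E).toReal} =
      1 - Phi (c - Real.sqrt (∑ i, μ i ^ 2)) := by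
  obtain ⟨w, hw, hμw⟩ := aux_dir N hN μ
  set s := Real.sqrt (∑ i, μ i ^ 2) with hs
  have hs0 : 0 ≤ s := Real.sqrt_nonneg _
  have hσ' : ∀ i, (σ i : ℝ) ≠ 0 := fun i => by exact_mod_cast (hσ i).ne'
  have hv : ∀ i, σ i ^ 2 ≠ 0 := fun i => pow_ne_zero _ (hσ i).ne'
  have hΔs : ∀ i, Δ i = s * w i * σ i := fun i => by
    rw [← hμw, hμ]; field_simp [hσ' i]
  let T : (Fin N → ℝ) → ℝ := ∑ i, fun x : Fin N → ℝ => (w i / σ i) * x i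
  have hTa : ∀ x, T x = ∑ i, (w i / σ i) * x i := fun x => by simp [T]
  have hTm : Measurable T := by
    have : T = fun x => ∑ i, (w i / σ i) * x i := funext hTa
    rw [this]; fun_prop
  have hvar : (∑ i, NNReal.mk ((w i / σ i) ^ 2) (sq_nonneg _) * σ i ^ 2) = 1 := by
    rw [← NNReal.coe_inj]
    push_cast
    rw [← hw]
    refine Finset.sum_congr rfl fun i _ => ?_
    have := hσ' i
    change (w i / σ i) ^ 2 * (σ i : ℝ) ^ 2 = _
    field_simp
  have hPT : P.map T = gaussianReal 0 1 := by
    rw [hP, aux_map_sum, hvar]; simp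
  have hQT : Q.map T = gaussianReal s 1 := by
    rw [hQ, aux_map_sum, hvar]
    congr 1
    calc _ = ∑ i, s * w i ^ 2 := Finset.sum_congr rfl fun i _ => by
            rw [hΔs]; have := hσ' i; field_simp
      _ = s := by rw [← Finset.mul_sum, hw, mul_one]
  have hPS : P.real (T ⁻¹' Ioi c) = κ := by
    have := aux_Ioi 0 c
    rw [← hPT, Measure.map_apply hTm measurableSet_Ioi, sub_zero, hc] at this
    rw [Measure.real, this]; ring
  have hQS : Q.real (T ⁻¹' Ioi c) = 1 - Phi (c - s) := by
    have := aux_Ioi s c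
    rwa [← hQT, Measure.map_apply hTm measurableSet_Ioi] at this
  have hPp : IsProbabilityMeasure P := by rw [hP]; infer_instance
  have hQp : IsProbabilityMeasure Q := by rw [hQ]; infer_instance
  have hd : Q = P.withDensity (fun x => ENNReal.ofReal (Real.exp (s * T x - s ^ 2 / 2))) := by
    rw [hQ, aux_pi_density N _ _ _ (fun i => by fun_prop)
      (fun i => aux_gauss_density (Δ i) (σ i ^ 2) (hv i)), ← hP]
    congr 1
    ext x
    rw [← ENNReal.ofReal_prod_of_nonneg (fun i _ => (Real.exp_pos _).le), ← Real.exp_sum]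
    congr 2
    rw [hTa, Finset.sum_sub_distrib, Finset.mul_sum]
    congr 1
    · refine Finset.sum_congr rfl fun i _ => ?_
      rw [hΔs]; have := hσ' i; push_cast; field_simp
    · calc _ = ∑ i, s ^ 2 / 2 * w i ^ 2 := Finset.sum_congr rfl fun i _ => by
            rw [hΔs]; have := hσ' i; push_cast; field_simp
        _ = s ^ 2 / 2 := by rw [← Finset.mul_sum, hw, mul_one]
  apply IsGreatest.csSup_eq
  constructor
  · exact ⟨T ⁻¹' Ioi c, hTm measurableSet_Ioi, hPS.le, hQS.symm⟩
  · rintro _ ⟨E, hE, hPE, rfl⟩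
    rw [← hQS]
    refine aux_NP P Q _ (by fun_prop) (fun x => (Real.exp_pos _).le) hd
      (Real.exp (s * c - s ^ 2 / 2)) (Real.exp_pos _).le _ E (hTm measurableSet_Ioi) hE ?_ ?_
      (by rw [hPS]; exact hPE)
    · intro x hx
      have hx' : c ≤ T x := le_of_lt hx
      gcongr
    · intro x hx
      have hx' : T x ≤ c := not_lt.1 hx
      gcongr
end

section
/- For every μ₁ ≥ 0, the function α ↦ f_Lap(α, μ₁), defined on [0,1] by f_Lap(α, μ₁) = 1 − α·e^{μ₁} if α < e^{−μ₁}/2, f_Lap(α, μ₁) = e^{−μ₁}/(4α) if e^{−μ₁}/2 ≤ α ≤ 1/2, and f_Lap(α, μ₁) = (1 − α)·e^{−μ₁} if α > 1/2, is continuous, convex, non-increasing on [0,1], and satisfies f_Lap(α, μ₁) ≤ 1 − α for all α ∈ [0,1]. (f_Lap is a valid trade-off function.) -/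
open Set

lemma fLap_eq_aux (μ₁ : ℝ) (hμ₁ : 0 ≤ μ₁) (y : ℝ) :
    fLap y μ₁ = Real.exp (-μ₁) / 2 * (max (Real.exp (-μ₁) / 2) (min y (1/2)))⁻¹
      - Real.exp (-μ₁) / 4 * ((max (Real.exp (-μ₁) / 2) (min y (1/2)))⁻¹)^2 * y := by
  have hc : 0 < Real.exp (-μ₁) := Real.exp_pos _
  have hc1 : Real.exp (-μ₁) ≤ 1 := Real.exp_le_one_iff.2 (by linarith)
  have he : Real.exp μ₁ = (Real.exp (-μ₁))⁻¹ := by rw [Real.exp_neg, inv_inv]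
  unfold fLap
  rw [he]
  generalize Real.exp (-μ₁) = c at *
  split_ifs with h1 h2
  · rw [min_eq_left (by linarith), max_eq_left h1.le]
    field_simp
    ring
  · rw [min_eq_left h2, max_eq_right (by linarith)]
    have : 0 < y := by linarith
    field_simp
    ring
  · rw [min_eq_right (by linarith), max_eq_right (by linarith)]
    ring

lemma fLap_sup_aux (μ₁ : ℝ) (hμ₁ : 0 ≤ μ₁) (y : ℝ) (hy : 0 ≤ y) :
    ∃ s : ℝ, 2 ≤ s ∧ Real.exp (-μ₁) * s ≤ 2 ∧
      fLap y μ₁ = Real.exp (-μ₁) / 2 * s - Real.exp (-μ₁) / 4 * s^2 * y ∧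
      ∀ a : ℝ, 2 ≤ a → Real.exp (-μ₁) * a ≤ 2 →
        Real.exp (-μ₁) / 2 * a - Real.exp (-μ₁) / 4 * a^2 * y ≤ fLap y μ₁ := by
  have hc : 0 < Real.exp (-μ₁) := Real.exp_pos _
  have hc1 : Real.exp (-μ₁) ≤ 1 := Real.exp_le_one_iff.2 (by linarith)
  rw [fLap_eq_aux μ₁ hμ₁]
  generalize Real.exp (-μ₁) = c at *
  obtain ⟨t, ht⟩ : ∃ t, t = max (c / 2) (min y (1/2)) := ⟨_, rfl⟩
  rw [← ht]
  have h1 : c / 2 ≤ t := ht ▸ le_max_left _ _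
  have h2 : t ≤ 1 / 2 := ht ▸ max_le (by linarith) (min_le_right _ _)
  have h0 : 0 < t := by linarith
  have hb : t * t⁻¹ = 1 := mul_inv_cancel₀ h0.ne'
  have hb0 : 0 < t⁻¹ := inv_pos.2 h0
  generalize t⁻¹ = b at *
  refine ⟨b, by nlinarith, by nlinarith, rfl, ?_⟩
  intro a ha hca
  suffices h : 0 ≤ (a - b) * ((a + b) * y - 2) by nlinarith [mul_nonneg hc.le h]
  rcases le_total y (c/2) with h | h
  · have : t = c / 2 := by rw [ht, min_eq_left (by linarith), max_eq_left h]
    subst this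
    have hab : a ≤ b := by
      by_contra! hh
      nlinarith
    apply mul_nonneg_of_nonpos_of_nonpos <;> nlinarith
  rcases le_total y (1/2) with h' | h'
  · have : t = y := by rw [ht, min_eq_left h', max_eq_right h]
    subst this
    have : (a - b) * ((a + b) * t - 2) = t * (a - b)^2 := by
      linear_combination 2 * (a - b) * hb
    rw [this]; positivity
  · have : t = 1 / 2 := by rw [ht, min_eq_right h', max_eq_right (by linarith)]
    subst this
    have : b = 2 := by linarith
    subst this
    apply mul_nonneg <;> nlinarith

/-- `f_Lap(·, μ₁)` is a valid trade-off function: continuous, convex,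
non-increasing on `[0,1]`, and bounded above by `1 - α`. -/
theorem fLap_is_tradeoff_function (μ₁ : ℝ) (hμ₁ : 0 ≤ μ₁) :
    ContinuousOn (fun α => fLap α μ₁) (Icc (0 : ℝ) 1) ∧
    ConvexOn ℝ (Icc (0 : ℝ) 1) (fun α => fLap α μ₁) ∧
    AntitoneOn (fun α => fLap α μ₁) (Icc (0 : ℝ) 1) ∧
    ∀ α ∈ Icc (0 : ℝ) 1, fLap α μ₁ ≤ 1 - α := by
  have hc : 0 < Real.exp (-μ₁) := Real.exp_pos _
  refine ⟨?_, ⟨convex_Icc _ _, ?_⟩, ?_, ?_⟩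
  · apply Continuous.continuousOn
    simp only [fLap_eq_aux μ₁ hμ₁]
    have h : Continuous fun y : ℝ => (max (Real.exp (-μ₁) / 2) (min y (1/2)))⁻¹ := by
      apply Continuous.inv₀ (by fun_prop)
      intro y
      exact (lt_of_lt_of_le (half_pos hc) (le_max_left _ _)).ne'
    fun_prop
  · intro x hx y hy p q hp hq hpq
    simp only [smul_eq_mul]
    obtain ⟨s, hs, hs', he, -⟩ := fLap_sup_aux μ₁ hμ₁ (p * x + q * y)
      (add_nonneg (mul_nonneg hp hx.1) (mul_nonneg hq hy.1))
    obtain ⟨-, -, -, -, h1⟩ := fLap_sup_aux μ₁ hμ₁ x hx.1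
    obtain ⟨-, -, -, -, h2⟩ := fLap_sup_aux μ₁ hμ₁ y hy.1
    have h1 := mul_le_mul_of_nonneg_left (h1 s hs hs') hp
    have h2 := mul_le_mul_of_nonneg_left (h2 s hs hs') hq
    rw [he]
    refine le_trans (le_of_eq ?_) (add_le_add h1 h2)
    linear_combination (-(Real.exp (-μ₁) / 2 * s)) * hpq
  · intro x hx y hy hxy
    obtain ⟨s, hs, hs', he, -⟩ := fLap_sup_aux μ₁ hμ₁ y hy.1
    obtain ⟨-, -, -, -, h1⟩ := fLap_sup_aux μ₁ hμ₁ x hx.1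
    refine le_trans ?_ (h1 s hs hs')
    simp only [he]
    gcongr
  · intro y hy
    obtain ⟨s, hs, hs', he, -⟩ := fLap_sup_aux μ₁ hμ₁ y hy.1
    rw [he]
    have h1 : 0 ≤ Real.exp (-μ₁) * s * (s - 2) * y :=
      mul_nonneg (mul_nonneg (mul_nonneg hc.le (by linarith)) (by linarith)) hy.1
    nlinarith [mul_nonneg (sub_nonneg.2 hs') (sub_nonneg.2 hy.2)]
end
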